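/- The class S_N contains L, contains R, and is closed under composition: if g: A ⟶ B and g': B ⟶ C both belong to S_N then g' ∘ g belongs to S_N. Consequently, S_N coincides with the smallest composition-closed class of morphisms containing L and R. -/

import Mathlib

open CategoryTheory CategoryTheory.Limits CategoryTheory.Pretriangulated

universe v u v₂ u₂

variable {C : Type u} [Category.{v} C] [Preadditive C] [HasZeroObject C]
  [HasShift C ℤ] [∀ n : ℤ, (shiftFunctor C n).Additive] [Pretriangulated C]

/-- `f : X ⟶ Y` factors through an object of `N`. -/
def FactorsThru (N : Set C) {X Y : C} (f : X ⟶ Y) : Prop :=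
  ∃ (Z : C) (_ : Z ∈ N) (u : X ⟶ Z) (v : Z ⟶ Y), f = u ≫ v

/-- The morphism `X⟦-1⟧ ⟶ A` obtained from `h : X ⟶ A⟦1⟧` by shifting by `-1` and
composing with the canonical isomorphism `A⟦1⟧⟦-1⟧ ≅ A`. -/
noncomputable def descShift {X A : C} (h : X ⟶ A⟦(1:ℤ)⟧) : X⟦(-1:ℤ)⟧ ⟶ A :=
  h⟦(-1:ℤ)⟧' ≫ (shiftEquiv C (1:ℤ)).unitIso.inv.app A

/-- The class `S_N` of morphisms fitting in a distinguished triangle whose two other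
maps factor through `N`. -/
def SN (N : Set C) {B C₀ : C} (g : B ⟶ C₀) : Prop :=
  ∃ (A : C) (f : A ⟶ B) (h : C₀ ⟶ A⟦(1:ℤ)⟧),
    (Triangle.mk f g h ∈ distTriang C) ∧ FactorsThru N f ∧ FactorsThru N h

/-- The class `L`. -/
def ClassL (N : Set C) {A B : C} (f : A ⟶ B) : Prop :=
  ∃ (N₀ : C) (_ : N₀ ∈ N) (g : B ⟶ N₀) (h : N₀ ⟶ A⟦(1:ℤ)⟧),
    (Triangle.mk f g h ∈ distTriang C) ∧ FactorsThru N (descShift h)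

/-- The class `R`. -/
def ClassR (N : Set C) {B C₀ : C} (g : B ⟶ C₀) : Prop :=
  ∃ (N₀ : C) (_ : N₀ ∈ N) (f : N₀ ⟶ B) (h : C₀ ⟶ N₀⟦(1:ℤ)⟧),
    (Triangle.mk f g h ∈ distTriang C) ∧ FactorsThru N h

/-- Condition (Lex) on a morphism `h : C₀ ⟶ A⟦1⟧`. -/
def LexCond (N : Set C) {C₀ A : C} (h : C₀ ⟶ A⟦(1:ℤ)⟧) : Prop :=
  ∀ (N₀ : C), N₀ ∈ N → ∀ (x : N₀ ⟶ C₀), FactorsThru N (descShift (x ≫ h))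

/-- Condition (Rex) on a morphism `h : C₀ ⟶ A⟦1⟧`. -/
def RexCond (N : Set C) {C₀ A : C} (h : C₀ ⟶ A⟦(1:ℤ)⟧) : Prop :=
  ∀ (N₀ : C), N₀ ∈ N → ∀ (y : A ⟶ N₀),
    ∃ (M : C) (_ : M ∈ N) (u : C₀⟦(-1:ℤ)⟧ ⟶ M⟦(-1:ℤ)⟧) (v : M⟦(-1:ℤ)⟧ ⟶ N₀),
      descShift h ≫ y = u ≫ v

/-- `S_N` as a morphism property. -/
def SNProp (N : Set C) : MorphismProperty C := fun _ _ g => SN N g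


namespace FactorsThru

variable {N : Set C}

lemma comp_left {W X Y : C} {f : X ⟶ Y} (hf : FactorsThru N f) (k : W ⟶ X) :
    FactorsThru N (k ≫ f) := by
  obtain ⟨Z, hZ, u, v, rfl⟩ := hf
  exact ⟨Z, hZ, k ≫ u, v, by simp⟩

lemma comp_right {X Y W : C} {f : X ⟶ Y} (hf : FactorsThru N f) (k : Y ⟶ W) :
    FactorsThru N (f ≫ k) := by
  obtain ⟨Z, hZ, u, v, rfl⟩ := hf
  exact ⟨Z, hZ, u, v ≫ k, by simp⟩

lemma of_source {X Y : C} (hX : X ∈ N) (f : X ⟶ Y) : FactorsThru N f :=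
  ⟨X, hX, 𝟙 X, f, by simp⟩

lemma neg {X Y : C} {f : X ⟶ Y} (hf : FactorsThru N f) : FactorsThru N (-f) := by
  obtain ⟨Z, hZ, u, v, rfl⟩ := hf
  exact ⟨Z, hZ, -u, v, by simp⟩

lemma add (hNext : ∀ (T : Triangle C), (T ∈ distTriang C) → T.obj₁ ∈ N → T.obj₃ ∈ N → T.obj₂ ∈ N)
    {X Y : C} {f g : X ⟶ Y} (hf : FactorsThru N f) (hg : FactorsThru N g) :
    FactorsThru N (f + g) := by
  obtain ⟨Z, hZ, u, v, rfl⟩ := hf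
  obtain ⟨Z', hZ', u', v', rfl⟩ := hg
  exact ⟨Z ⊞ Z', hNext _ (binaryBiproductTriangle_distinguished Z Z') hZ hZ',
    biprod.lift u u', biprod.desc v v', by simp⟩

end FactorsThru

/-! Unbundled exactness and completion properties of distinguished triangles. -/

section DistTriang

variable {X Y Z : C} {f : X ⟶ Y} {g : Y ⟶ Z} {h : Z ⟶ X⟦(1 : ℤ)⟧}

lemma exists_lift_fst (hT : Triangle.mk f g h ∈ distTriang C) {W : C} (ψ : W ⟶ Y)
    (hψ : ψ ≫ g = 0) : ∃ z : W ⟶ X, ψ = z ≫ f :=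
  Triangle.coyoneda_exact₂ _ hT ψ hψ

lemma exists_lift_snd (hT : Triangle.mk f g h ∈ distTriang C) {W : C} (ψ : W ⟶ Z)
    (hψ : ψ ≫ h = 0) : ∃ z : W ⟶ Y, ψ = z ≫ g :=
  Triangle.coyoneda_exact₃ _ hT ψ hψ

lemma exists_desc_snd (hT : Triangle.mk f g h ∈ distTriang C) {W : C} (ψ : Y ⟶ W)
    (hψ : f ≫ ψ = 0) : ∃ z : Z ⟶ W, ψ = g ≫ z :=
  Triangle.yoneda_exact₂ _ hT ψ hψ

lemma exists_desc_trd (hT : Triangle.mk f g h ∈ distTriang C) {W : C} (ψ : Z ⟶ W)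
    (hψ : g ≫ ψ = 0) : ∃ z : X⟦(1 : ℤ)⟧ ⟶ W, ψ = h ≫ z :=
  Triangle.yoneda_exact₃ _ hT ψ hψ

lemma distTriang_comp_fst_snd (hT : Triangle.mk f g h ∈ distTriang C) : f ≫ g = 0 :=
  comp_distTriang_mor_zero₁₂ _ hT

lemma distTriang_comp_snd_trd (hT : Triangle.mk f g h ∈ distTriang C) : g ≫ h = 0 :=
  comp_distTriang_mor_zero₂₃ _ hT

lemma distTriang_comp_trd_shift (hT : Triangle.mk f g h ∈ distTriang C) :
    h ≫ f⟦(1 : ℤ)⟧' = 0 :=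
  comp_distTriang_mor_zero₃₁ _ hT

lemma exists_middle_map (hT : Triangle.mk f g h ∈ distTriang C)
    {X' Y' Z' : C} {f' : X' ⟶ Y'} {g' : Y' ⟶ Z'} {h' : Z' ⟶ X'⟦(1 : ℤ)⟧}
    (hT' : Triangle.mk f' g' h' ∈ distTriang C) (a : X ⟶ X') (c : Z ⟶ Z')
    (comm : h ≫ a⟦(1 : ℤ)⟧' = c ≫ h') :
    ∃ b : Y ⟶ Y', f ≫ b = a ≫ f' ∧ g ≫ c = b ≫ g' :=
  complete_distinguished_triangle_morphism₂ _ _ hT hT' a c comm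

/-- A morphism out of the first object of a distinguished triangle extends to the second object
when it kills the connecting morphism. -/
lemma exists_extension (hT : Triangle.mk f g h ∈ distTriang C) {W : C}
    (a : X ⟶ W) (ha : h ≫ a⟦(1 : ℤ)⟧' = 0) : ∃ b : Y ⟶ W, f ≫ b = a := by
  obtain ⟨b, hb, -⟩ := exists_middle_map hT (contractible_distinguished W) a 0
    (by rw [ha, zero_comp])
  exact ⟨b, by rw [hb, Category.comp_id]⟩

end DistTriang

/-- If the fibre of `g` maps to `A` through `N`, a morphism into `A` factors through `N` as soon
as its composition with `g` does. -/
lemma factorsThru_of_comp_right {N : Set C}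
    (hNext : ∀ (T : Triangle C), (T ∈ distTriang C) → T.obj₁ ∈ N → T.obj₃ ∈ N → T.obj₂ ∈ N)
    {X A B F : C} {f : X ⟶ A} {g : A ⟶ B} {h : B ⟶ X⟦(1 : ℤ)⟧}
    (hT : Triangle.mk f g h ∈ distTriang C) (hf : FactorsThru N f)
    (φ : F ⟶ A) (hφ : FactorsThru N (φ ≫ g)) : FactorsThru N φ := by
  have hf' := hf
  obtain ⟨N₁, hN₁, p, a, hpa⟩ := hf'
  obtain ⟨N', hN', u, v, huv⟩ := hφ
  have hgh : g ≫ h = 0 := distTriang_comp_snd_trd hT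
  have hhf : h ≫ f⟦(1 : ℤ)⟧' = 0 := distTriang_comp_trd_shift hT
  obtain ⟨E, i, j, hE⟩ := distinguished_cocone_triangle₂ (v ≫ h)
  obtain ⟨ε, hiε, hjε⟩ := exists_middle_map hE hT (𝟙 X) v
    (by rw [CategoryTheory.Functor.map_id, Category.comp_id])
  obtain ⟨c, hc⟩ := exists_lift_snd hE u
    (by rw [← Category.assoc, ← huv, Category.assoc, hgh, comp_zero])
  obtain ⟨z, hz⟩ := exists_lift_fst hT (φ - c ≫ ε) (by
    rw [Preadditive.sub_comp, Category.assoc, ← hjε, ← Category.assoc, ← hc, huv, sub_self])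
  obtain ⟨M, m, n, hM⟩ := distinguished_cocone_triangle₂ ((v ≫ h) ≫ p⟦(1 : ℤ)⟧')
  have hMN : M ∈ N := hNext _ hM hN₁ hN'
  obtain ⟨μ, hiμ, hjμ⟩ := exists_middle_map hE hM p (𝟙 N')
    (Category.id_comp _).symm
  obtain ⟨b, hb⟩ := exists_extension hM a (by
    rw [Category.assoc, Category.assoc, ← Functor.map_comp, ← hpa, hhf, comp_zero])
  obtain ⟨y, hy⟩ := exists_desc_snd hE (ε - μ ≫ b) (by
    rw [Preadditive.comp_sub, hiε, ← Category.assoc, hiμ, Category.assoc, hb, Category.id_comp,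
      hpa, sub_self])
  have hε : FactorsThru N ε := by
    rw [← sub_add_cancel ε (μ ≫ b)]
    refine FactorsThru.add hNext ?_ ⟨M, hMN, μ, b, rfl⟩
    exact ⟨N', hN', j, y, hy⟩
  rw [← sub_add_cancel φ (c ≫ ε)]
  refine FactorsThru.add hNext ?_ (hε.comp_left c)
  rw [hz]
  exact hf.comp_left z

/-- If the connecting morphism of the cofibre of `g` factors through `N`, a morphism out of `B`
factors through `N` as soon as its precomposition with `g` does. -/
lemma factorsThru_of_comp_left {N : Set C}
    (hNext : ∀ (T : Triangle C), (T ∈ distTriang C) → T.obj₁ ∈ N → T.obj₃ ∈ N → T.obj₂ ∈ N)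
    {A B X F : C} {g : A ⟶ B} {h : B ⟶ X} {k : X ⟶ A⟦(1 : ℤ)⟧}
    (hT : Triangle.mk g h k ∈ distTriang C) (hh : FactorsThru N h)
    (φ : B ⟶ F) (hφ : FactorsThru N (g ≫ φ)) : FactorsThru N φ := by
  have hh' := hh
  obtain ⟨N₁, hN₁, p, a, hpa⟩ := hh'
  obtain ⟨N', hN', u, v, huv⟩ := hφ
  have hhk : h ≫ k = 0 := distTriang_comp_snd_trd hT
  have hkg : k ≫ g⟦(1 : ℤ)⟧' = 0 := distTriang_comp_trd_shift hT
  obtain ⟨E, i, j, hE⟩ := distinguished_cocone_triangle₂ (k ≫ u⟦(1 : ℤ)⟧')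
  obtain ⟨ε, hiε, hjε⟩ := exists_middle_map hT hE u (𝟙 X)
    (Category.id_comp _).symm
  obtain ⟨c, hc⟩ := exists_extension hE v (by
    rw [Category.assoc, ← Functor.map_comp, ← huv, Functor.map_comp, ← Category.assoc, hkg,
      zero_comp])
  obtain ⟨z, hz⟩ := exists_desc_snd hT (φ - ε ≫ c) (by
    rw [Preadditive.comp_sub, ← Category.assoc, hiε, Category.assoc, hc, huv, sub_self])
  obtain ⟨M, m, n, hM⟩ := distinguished_cocone_triangle₂ (a ≫ k ≫ u⟦(1 : ℤ)⟧')
  have hMN : M ∈ N := hNext _ hM hN' hN₁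
  obtain ⟨μ, hmμ, hnμ⟩ := exists_middle_map hM hE (𝟙 N') a
    (by rw [CategoryTheory.Functor.map_id, Category.comp_id])
  obtain ⟨b, hb⟩ := exists_lift_snd hM p (by
    rw [← Category.assoc, ← hpa, ← Category.assoc, hhk, zero_comp])
  obtain ⟨y, hy⟩ := exists_lift_fst hE (ε - b ≫ μ) (by
    rw [Preadditive.sub_comp, ← hjε, Category.assoc, ← hnμ, ← Category.assoc, ← hb,
      Category.comp_id, hpa, sub_self])
  have hε : FactorsThru N ε := by
    rw [← sub_add_cancel ε (b ≫ μ)]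
    refine FactorsThru.add hNext ?_ ⟨M, hMN, b, μ, rfl⟩
    exact ⟨N', hN', y, i, hy⟩
  rw [← sub_add_cancel φ (ε ≫ c)]
  refine FactorsThru.add hNext ?_ (hε.comp_right c)
  rw [hz]
  exact hh.comp_right z

lemma descShift_comp_shift {X A B : C} (t : X ⟶ A⟦(1 : ℤ)⟧) (f : A ⟶ B) :
    descShift (t ≫ f⟦(1 : ℤ)⟧') = descShift t ≫ f := by
  have hnat : (f⟦(1 : ℤ)⟧')⟦(-1 : ℤ)⟧' ≫ (shiftEquiv C (1 : ℤ)).unitIso.inv.app B =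
      (shiftEquiv C (1 : ℤ)).unitIso.inv.app A ≫ f :=
    (shiftEquiv C (1 : ℤ)).unitIso.inv.naturality f
  unfold descShift
  rw [Functor.map_comp]
  exact (Category.assoc _ _ _).trans ((congrArg (fun x ↦ t⟦(-1 : ℤ)⟧' ≫ x) hnat).trans
    (Category.assoc _ _ _).symm)

lemma invRotate_descShift_distinguished {A B D : C} {f : A ⟶ B} {g : B ⟶ D}
    {h : D ⟶ A⟦(1 : ℤ)⟧} (hT : Triangle.mk f g h ∈ distTriang C) :
    Triangle.mk (-descShift h) f (g ≫ (shiftEquiv C (1 : ℤ)).counitIso.inv.app D) ∈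
      distTriang C := by
  have hrot := inv_rot_of_distTriang _ hT
  convert hrot using 1
  simp [Triangle.invRotate, descShift]
  rfl

lemma ClassL.sn {N : Set C} {A B : C} {f : A ⟶ B} (hf : ClassL N f) : SN N f := by
  obtain ⟨N₀, hN₀, g, h, hT, hh⟩ := hf
  exact ⟨N₀⟦(-1 : ℤ)⟧, -descShift h, _, invRotate_descShift_distinguished hT,
    hh.neg, N₀, hN₀, g, _, rfl⟩

lemma ClassR.sn {N : Set C} {B C₀ : C} {g : B ⟶ C₀} (hg : ClassR N g) : SN N g := by
  obtain ⟨N₀, hN₀, f, h, hT, hh⟩ := hg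
  exact ⟨N₀, f, h, hT, FactorsThru.of_source hN₀ f, hh⟩

lemma SN.comp {N : Set C}
    (hNext : ∀ (T : Triangle C), (T ∈ distTriang C) → T.obj₁ ∈ N → T.obj₃ ∈ N → T.obj₂ ∈ N)
    {X Y Z : C} {g : X ⟶ Y} {g' : Y ⟶ Z} (hg : SN N g) (hg' : SN N g') :
    SN N (g ≫ g') := by
  obtain ⟨A, f, h, hT, hf, hh⟩ := hg
  obtain ⟨A', f', h', hT', hf', hh'⟩ := hg'
  obtain ⟨G, k, q, hG⟩ := distinguished_cocone_triangle₁ (g ≫ g')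
  refine ⟨G, k, q, hG, ?_, ?_⟩
  · refine factorsThru_of_comp_right hNext hT hf k ?_
    obtain ⟨z, hz⟩ := exists_lift_fst hT' (k ≫ g)
      (by rw [Category.assoc, distTriang_comp_fst_snd hG])
    rw [hz]
    exact hf'.comp_left z
  · refine factorsThru_of_comp_left hNext (rot_of_distTriang _ hT') hh' q ?_
    obtain ⟨z, hz⟩ := exists_desc_trd hT (g' ≫ q)
      (by rw [← Category.assoc, distTriang_comp_snd_trd hG])
    change FactorsThru N (g' ≫ q)
    rw [hz]
    exact hh.comp_right z

/-- A morphism of `S_N` is a morphism of `L` followed by a morphism of `R`, which can be taken to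
be a split epimorphism. -/
lemma SN.exists_classL_classR {N : Set C}
    (hNsum : ∀ ⦃X Z : C⦄ (i : X ⟶ Z) (r : Z ⟶ X), i ≫ r = 𝟙 X → Z ∈ N → X ∈ N)
    (hNext : ∀ (T : Triangle C), (T ∈ distTriang C) → T.obj₁ ∈ N → T.obj₃ ∈ N → T.obj₂ ∈ N)
    {X Y : C} {g : X ⟶ Y} (hg : SN N g) :
    ∃ (D : C) (l : X ⟶ D) (d : D ⟶ Y), ClassL N l ∧ ClassR N d ∧ l ≫ d = g := by
  obtain ⟨A, f, h, hT, hf, N₂, hN₂, s, t, hst⟩ := hg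
  obtain ⟨D, l, e, hD⟩ := distinguished_cocone_triangle₂ ((-t) ≫ f⟦(1 : ℤ)⟧')
  have hhf := distTriang_comp_trd_shift hT
  obtain ⟨d, hld, hed⟩ : ∃ d : D ⟶ Y, l ≫ d = g ∧ e ≫ t = d ≫ h := by
    obtain ⟨d, hld, hed⟩ := exists_middle_map hD (rot_of_distTriang _ hT) (𝟙 X) t (by
      change ((-t) ≫ f⟦(1 : ℤ)⟧') ≫ (𝟙 X)⟦(1 : ℤ)⟧' = t ≫ (-f⟦(1 : ℤ)⟧')
      rw [CategoryTheory.Functor.map_id, Category.comp_id, Preadditive.neg_comp,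
        Preadditive.comp_neg])
    exact ⟨d, hld.trans (Category.id_comp g), hed⟩
  have hl : ClassL N l := by
    refine ⟨N₂, hN₂, e, _, hD, ?_⟩
    rw [descShift_comp_shift]
    exact hf.comp_left _
  obtain ⟨σ₀, hσ₀⟩ := exists_lift_snd hD s (by
    rw [Preadditive.neg_comp, Preadditive.comp_neg, ← Category.assoc, ← hst, hhf, neg_zero])
  obtain ⟨y, hy⟩ := exists_lift_snd hT (𝟙 Y - σ₀ ≫ d) (by
    rw [Preadditive.sub_comp, Category.assoc, ← hed, ← Category.assoc, ← hσ₀, ← hst,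
      Category.id_comp, sub_self])
  obtain ⟨σ, hσ⟩ : ∃ σ : Y ⟶ D, σ ≫ d = 𝟙 Y :=
    ⟨σ₀ + y ≫ l, by rw [Preadditive.add_comp, Category.assoc, hld, ← hy, add_sub_cancel]⟩
  obtain ⟨K, k, δ, hK⟩ := distinguished_cocone_triangle₁ d
  have hkd := distTriang_comp_fst_snd hK
  have hδ : δ = 0 := by
    rw [← Category.id_comp δ, ← hσ, Category.assoc, distTriang_comp_snd_trd hK, comp_zero]
  have : Mono k := Triangle.mono₁ _ hK hδ
  obtain ⟨r, hr⟩ := exists_lift_fst hK (𝟙 D - d ≫ σ) (by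
    rw [Preadditive.sub_comp, Category.assoc, hσ, Category.id_comp, Category.comp_id, sub_self])
  have hkr : k ≫ r = 𝟙 K := by
    rw [← cancel_mono k, Category.assoc, ← hr, Preadditive.comp_sub, ← Category.assoc k d, hkd,
      zero_comp, sub_zero, Category.comp_id, Category.id_comp]
  have hKN : K ∈ N := by
    obtain ⟨N₁, hN₁, p, a, hpa⟩ := hf
    obtain ⟨U, u, w', hU⟩ := distinguished_cocone_triangle (a ≫ l ≫ r)
    have hwu := distTriang_comp_fst_snd hU
    obtain ⟨x, hx⟩ := exists_desc_snd hT (l ≫ r ≫ u) (by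
      simp only [Category.assoc] at hwu
      rw [hpa, Category.assoc, hwu, comp_zero])
    obtain ⟨z, hz⟩ := exists_desc_snd hD (r ≫ u - d ≫ x) (by
      rw [Preadditive.comp_sub, hx, ← Category.assoc l d, hld, sub_self])
    have hu : u = (k ≫ e) ≫ z := by
      rw [Category.assoc, ← hz, Preadditive.comp_sub, ← Category.assoc, hkr, ← Category.assoc k d,
        hkd, zero_comp, sub_zero, Category.id_comp]
    obtain ⟨M, hM, i, j, hij⟩ := factorsThru_of_comp_right hNext hU
      (FactorsThru.of_source hN₁ _) (𝟙 K) ⟨N₂, hN₂, k ≫ e, z, by rw [Category.id_comp, hu]⟩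
    exact hNsum i j hij.symm hM
  refine ⟨D, l, d, hl, ⟨K, hKN, k, δ, hK, ?_⟩, hld⟩
  exact ⟨K, hKN, 0, 0, by rw [hδ, comp_zero]⟩

theorem stmt6 (N : Set C)
    (hN0 : ∀ X : C, Limits.IsZero X → X ∈ N)
    (hNiso : ∀ ⦃X Y : C⦄, (X ≅ Y) → X ∈ N → Y ∈ N)
    (hNsum : ∀ ⦃X Z : C⦄ (i : X ⟶ Z) (r : Z ⟶ X), i ≫ r = 𝟙 X → Z ∈ N → X ∈ N)
    (hNext : ∀ (T : Triangle C), (T ∈ distTriang C) → T.obj₁ ∈ N → T.obj₃ ∈ N → T.obj₂ ∈ N)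
    :
    (∀ ⦃X Y : C⦄ (f : X ⟶ Y), ClassL N f → SN N f) ∧
    (∀ ⦃X Y : C⦄ (g : X ⟶ Y), ClassR N g → SN N g) ∧
    (∀ ⦃X Y Z : C⦄ (g : X ⟶ Y) (g' : Y ⟶ Z), SN N g → SN N g' → SN N (g ≫ g')) ∧
    (∀ (P : MorphismProperty C),
      (∀ ⦃X Y : C⦄ (f : X ⟶ Y), ClassL N f → P f) →
      (∀ ⦃X Y : C⦄ (g : X ⟶ Y), ClassR N g → P g) →
      (∀ ⦃X Y Z : C⦄ (u : X ⟶ Y) (v : Y ⟶ Z), P u → P v → P (u ≫ v)) →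
      ∀ ⦃X Y : C⦄ (g : X ⟶ Y), SN N g → P g) := by
  refine ⟨fun _ _ _ hf ↦ hf.sn, fun _ _ _ hg ↦ hg.sn, fun _ _ _ _ _ hg hg' ↦ hg.comp hNext hg',
    fun P hL hR hP _ _ g hg ↦ ?_⟩
  obtain ⟨D, l, d, hl, hd, rfl⟩ := hg.exists_classL_classR hNsum hNext
  exact hP l d (hL l hl) (hR d hd)
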